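/- arXiv:1912.00924 — 2 statements merged into one kernel-verified Lean document; each statement's English description precedes it below -/
import Mathlib

section
/- Let σ ≥ 0, σ' ≥ 0, β, β' ∈ ℝ and κ ∈ ℝ with κ ≠ 0, and define f : ℝ × ℤ/2ℤ → ℂ by f(s,0) = exp(−σs² + iβs) and f(s,1) = κ·exp(−σ's² + iβ's). Let μ be a finite signed measure on ℝ × ℤ/2ℤ with μ̂ = f. Then μ is a nonnegative measure if and only if either (0 < σ' < σ and |κ| ≤ √(σ'/σ)·exp(−(β−β')²/(4(σ−σ')))) or (σ' = σ, β = β' and |κ| ≤ 1). Moreover, in the latter case μ is the convolution of a Gaussian measure concentrated on ℝ × {0} and a probability measure concentrated on {0} × ℤ/2ℤ. -/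
open MeasureTheory Complex

noncomputable section

/-- The character of `ℝ × ℤ/2ℤ` with parameter `(s, l)`, evaluated at `(t, k)`:
`exp(i s t)·(−1)^{l k}`. -/
def charZ2 (s : ℝ) (l : ZMod 2) (p : ℝ × ZMod 2) : ℂ :=
  Complex.exp (Complex.I * s * p.1) * (-1 : ℂ) ^ (l * p.2).val

/-- The characteristic function of a finite signed measure on `ℝ × ℤ/2ℤ`, defined through
its Jordan decomposition. -/
def sCharZ2 (μ : SignedMeasure (ℝ × ZMod 2)) (s : ℝ) (l : ZMod 2) : ℂ :=
  (∫ p, charZ2 s l p ∂μ.toJordanDecomposition.posPart) -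
    (∫ p, charZ2 s l p ∂μ.toJordanDecomposition.negPart)

open ProbabilityTheory

lemma charFun_add_measure (A B : Measure ℝ) [IsFiniteMeasure A] [IsFiniteMeasure B] (s : ℝ) :
    charFun (A + B) s = charFun A s + charFun B s := by
  simp only [charFun_eq_integral_innerProbChar]
  exact integral_add_measure (BoundedContinuousFunction.integrable _ _)
    (BoundedContinuousFunction.integrable _ _)

lemma charFun_smul_measure (c : NNReal) (A : Measure ℝ) (s : ℝ) :
    charFun (c • A) s = c * charFun A s := by
  simp only [charFun_apply]
  rw [integral_smul_nnreal_measure, NNReal.smul_def, Complex.real_smul]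

lemma measureReal_sub_eq_of_charFun_sub_eq {A B H : Measure ℝ} [IsFiniteMeasure A]
    [IsFiniteMeasure B] [IsFiniteMeasure H] {c : ℝ}
    (h : ∀ s, charFun A s - charFun B s = c * charFun H s) (S : Set ℝ) :
    A.real S - B.real S = c * H.real S := by
  wlog hc : 0 ≤ c generalizing A B c
  · have := this (A := B) (B := A) (c := -c)
      (fun s ↦ by rw [← neg_sub, h]; push_cast; ring) (by linarith)
    linarith
  lift c to NNReal using hc
  have hAB : A = B + c • H := by
    refine Measure.ext_of_charFun (funext fun s ↦ ?_)
    rw [charFun_add_measure, charFun_smul_measure, add_comm]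
    exact sub_eq_iff_eq_add.mp (h s)
  rw [hAB, measureReal_add_apply, measureReal_nnreal_smul_apply]
  ring

/-- The part of a measure on `ℝ × ℤ/2ℤ` carried by `ℝ × {k}`, as a measure on `ℝ`. -/
def fiberMeasure (m : Measure (ℝ × ZMod 2)) (k : ZMod 2) : Measure ℝ :=
  (m.restrict {p | p.2 = k}).map Prod.fst

lemma measurableSet_snd_eq (k : ZMod 2) : MeasurableSet {p : ℝ × ZMod 2 | p.2 = k} :=
  measurable_snd (measurableSet_singleton k)

instance (m : Measure (ℝ × ZMod 2)) [IsFiniteMeasure m] (k : ZMod 2) :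
    IsFiniteMeasure (fiberMeasure m k) := by
  unfold fiberMeasure; infer_instance

lemma fiberMeasure_real_apply (m : Measure (ℝ × ZMod 2)) (k : ZMod 2) {S : Set ℝ}
    (hS : MeasurableSet S) : (fiberMeasure m k).real S = m.real (S ×ˢ {k}) := by
  rw [fiberMeasure, map_measureReal_apply measurable_fst hS,
    measureReal_restrict_apply (measurable_fst hS)]
  congr 1

lemma charFun_fiberMeasure (m : Measure (ℝ × ZMod 2)) (k : ZMod 2) (s : ℝ) :
    charFun (fiberMeasure m k) s = ∫ p in {p | p.2 = k}, cexp (I * s * p.1) ∂m := by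
  rw [fiberMeasure, charFun_apply_real, integral_map (by fun_prop) (by fun_prop)]
  simp only [mul_comm, mul_left_comm]

lemma zmod_two_eq_zero_or_one : ∀ k : ZMod 2, k = 0 ∨ k = 1 := by
  decide

lemma integral_charZ2 (m : Measure (ℝ × ZMod 2)) [IsFiniteMeasure m] (s : ℝ) (l : ZMod 2) :
    ∫ p, charZ2 s l p ∂m =
      charFun (fiberMeasure m 0) s + (-1) ^ l.val * charFun (fiberMeasure m 1) s := by
  have hcompl : {p : ℝ × ZMod 2 | p.2 = 0}ᶜ = {p | p.2 = 1} := by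
    ext ⟨t, k⟩
    obtain rfl | rfl := zmod_two_eq_zero_or_one k <;> simp
  have hmeas : Measurable (charZ2 s l) := by
    have : Measurable fun k : ZMod 2 ↦ (-1 : ℂ) ^ (l * k).val := measurable_of_finite _
    unfold charZ2
    fun_prop
  have hint : Integrable (charZ2 s l) m := by
    refine Integrable.of_bound hmeas.aestronglyMeasurable 1 (ae_of_all _ fun p ↦ ?_)
    have : I * s * p.1 = ((s * p.1 : ℝ) : ℂ) * I := by push_cast; ring
    simp [charZ2, this, -ofReal_mul, Complex.norm_exp_ofReal_mul_I]
  rw [← integral_add_compl (measurableSet_snd_eq 0) hint, hcompl, charFun_fiberMeasure,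
    charFun_fiberMeasure, ← integral_const_mul]
  congr 1
  · refine setIntegral_congr_fun (measurableSet_snd_eq 0) fun p (hp : p.2 = 0) ↦ ?_
    simp [charZ2, hp]
  · refine setIntegral_congr_fun (measurableSet_snd_eq 1) fun p (hp : p.2 = 1) ↦ ?_
    simp [charZ2, hp, mul_comm]

lemma signedMeasure_apply (μ : SignedMeasure (ℝ × ZMod 2)) {S : Set (ℝ × ZMod 2)}
    (hS : MeasurableSet S) :
    μ S = μ.toJordanDecomposition.posPart.real S - μ.toJordanDecomposition.negPart.real S := by
  conv_lhs => rw [← μ.toSignedMeasure_toJordanDecomposition]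
  rw [JordanDecomposition.toSignedMeasure, _root_.sub_apply,
    Measure.toSignedMeasure_apply_measurable hS, Measure.toSignedMeasure_apply_measurable hS]

lemma vectorMeasure_apply_eq_add_fibers (v : SignedMeasure (ℝ × ZMod 2))
    {S : Set (ℝ × ZMod 2)} (hS : MeasurableSet S) :
    v S = v (((·, 0) ⁻¹' S) ×ˢ {0}) + v (((·, 1) ⁻¹' S) ×ˢ {1}) := by
  have hmeas (k : ZMod 2) : MeasurableSet (((·, k) ⁻¹' S : Set ℝ) ×ˢ {k}) :=
    (measurable_prodMk_right hS).prod (measurableSet_singleton k)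
  rw [← VectorMeasure.of_union _ (hmeas 0) (hmeas 1)]
  · congr 1
    ext ⟨t, k⟩
    obtain rfl | rfl := zmod_two_eq_zero_or_one k <;> simp
  · rw [Set.disjoint_left]
    rintro ⟨t, k⟩ ⟨-, h0⟩ ⟨-, h1⟩
    simp_all

lemma gaussian_charFun_eq {σ : ℝ} (hσ : 0 ≤ σ) (β s : ℝ) :
    charFun (gaussianReal β (2 * σ).toNNReal) s =
      cexp (-(σ : ℂ) * (s : ℂ) ^ 2 + I * (β : ℂ) * (s : ℂ)) := by
  rw [charFun_gaussianReal, Real.coe_toNNReal _ (by positivity)]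
  congr 1
  push_cast
  ring

lemma signedMeasure_apply_fiber {μ : SignedMeasure (ℝ × ZMod 2)} {G H : Measure ℝ}
    [IsFiniteMeasure G] [IsFiniteMeasure H] {c : ℝ} (h0 : ∀ s, sCharZ2 μ s 0 = charFun G s)
    (h1 : ∀ s, sCharZ2 μ s 1 = c * charFun H s) {S : Set ℝ} (hS : MeasurableSet S) :
    μ (S ×ˢ {0}) = (G.real S + c * H.real S) / 2 ∧
      μ (S ×ˢ {1}) = (G.real S - c * H.real S) / 2 := by
  set P := μ.toJordanDecomposition.posPart
  set N := μ.toJordanDecomposition.negPart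
  have hsum := measureReal_sub_eq_of_charFun_sub_eq (A := fiberMeasure P 0 + fiberMeasure P 1)
    (B := fiberMeasure N 0 + fiberMeasure N 1) (H := G) (c := 1) (fun s ↦ by
      rw [ofReal_one, one_mul, ← h0, sCharZ2, integral_charZ2, integral_charZ2,
        charFun_add_measure, charFun_add_measure]
      simp [P, N]) S
  have hsub := measureReal_sub_eq_of_charFun_sub_eq (A := fiberMeasure P 0 + fiberMeasure N 1)
    (B := fiberMeasure N 0 + fiberMeasure P 1) (H := H) (c := c) (fun s ↦ by
      rw [← h1, sCharZ2, integral_charZ2, integral_charZ2,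
        charFun_add_measure, charFun_add_measure]
      simp [P, N, ZMod.val_one]
      ring) S
  rw [measureReal_add_apply, measureReal_add_apply] at hsum hsub
  simp only [fiberMeasure_real_apply _ _ hS] at hsum hsub
  rw [signedMeasure_apply μ (hS.prod (measurableSet_singleton 0)),
    signedMeasure_apply μ (hS.prod (measurableSet_singleton 1))]
  constructor <;> linarith

lemma signedMeasure_nonneg_iff {μ : SignedMeasure (ℝ × ZMod 2)} {G H : Measure ℝ} {c : ℝ}
    (h : ∀ S, MeasurableSet S → μ (S ×ˢ {0}) = (G.real S + c * H.real S) / 2 ∧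
      μ (S ×ˢ {1}) = (G.real S - c * H.real S) / 2) :
    0 ≤ μ ↔ ∀ S, MeasurableSet S → |c| * H.real S ≤ G.real S := by
  have key (S : Set ℝ) : |c| * H.real S = |c * H.real S| := by
    rw [abs_mul, abs_of_nonneg measureReal_nonneg]
  simp only [key, abs_le]
  rw [VectorMeasure.le_iff]
  constructor
  · intro hμ S hS
    have h0 := hμ _ (hS.prod (measurableSet_singleton (0 : ZMod 2)))
    have h1 := hμ _ (hS.prod (measurableSet_singleton (1 : ZMod 2)))
    rw [(h S hS).1, _root_.zero_apply] at h0
    rw [(h S hS).2, _root_.zero_apply] at h1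
    constructor <;> linarith
  · intro hGH S hS
    have m0 : MeasurableSet ((·, (0 : ZMod 2)) ⁻¹' S : Set ℝ) := measurable_prodMk_right hS
    have m1 : MeasurableSet ((·, (1 : ZMod 2)) ⁻¹' S : Set ℝ) := measurable_prodMk_right hS
    rw [vectorMeasure_apply_eq_add_fibers μ hS, (h _ m0).1, (h _ m1).2, _root_.zero_apply]
    have := hGH _ m0
    have := hGH _ m1
    linarith

lemma nonneg_coeffs_of_quadratic_nonneg {a b c : ℝ} (h : ∀ t : ℝ, 0 ≤ a * t ^ 2 + b * t + c) :
    0 ≤ a ∧ (a = 0 → b = 0) := by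
  constructor
  · by_contra! ha
    have hc : 0 ≤ c := by simpa using h 0
    set t := 1 + c / (-a)
    have h1 := h t
    have h2 := h (-t)
    have hd : 0 ≤ c / (-a) := div_nonneg hc (by linarith)
    have hmul : a * (c / (-a)) = -c := by field_simp [ha.ne]
    have ht : t ≤ t ^ 2 := by nlinarith [show 1 ≤ t from by simp only [t]; linarith]
    nlinarith [show a * t = a - c from by simp only [t]; linarith]
  · rintro rfl
    by_contra hb
    have := h (-(c + 1) / b)
    have hm : b * (-(c + 1) / b) = -(c + 1) := by field_simp
    linarith

lemma gaussian_pointwise_le_iff {σ σ' β β' k : ℝ} (hσ : 0 < σ) (hσ' : 0 < σ') (hk : 0 < k) :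
    (∀ t : ℝ, k ≤ √(σ' / σ) *
        Real.exp ((t - β') ^ 2 / (4 * σ') - (t - β) ^ 2 / (4 * σ))) ↔
      (σ' < σ ∧ k ≤ √(σ' / σ) * Real.exp (-(β - β') ^ 2 / (4 * (σ - σ')))) ∨
      (σ' = σ ∧ β = β' ∧ k ≤ 1) := by
  have hr : 0 < √(σ' / σ) := Real.sqrt_pos.mpr (by positivity)
  constructor
  · intro h
    have hlog (t : ℝ) : Real.log (k / √(σ' / σ)) ≤
        (t - β') ^ 2 / (4 * σ') - (t - β) ^ 2 / (4 * σ) := by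
      rw [Real.log_le_iff_le_exp (by positivity), div_le_iff₀' hr]
      exact h t
    obtain ⟨ha, hb⟩ := nonneg_coeffs_of_quadratic_nonneg (a := 1 / (4 * σ') - 1 / (4 * σ))
      (b := β / (2 * σ) - β' / (2 * σ'))
      (c := β' ^ 2 / (4 * σ') - β ^ 2 / (4 * σ) - Real.log (k / √(σ' / σ)))
      (fun t ↦ by
        have := hlog t
        calc 0 ≤ (t - β') ^ 2 / (4 * σ') - (t - β) ^ 2 / (4 * σ) - Real.log (k / √(σ' / σ)) := by
              linarith
          _ = _ := by ring)
    have hle : σ' ≤ σ := by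
      have := (one_div_le_one_div (by positivity) (by positivity)).mp (sub_nonneg.mp ha)
      linarith
    rcases hle.lt_or_eq with hlt | rfl
    · left
      refine ⟨hlt, ?_⟩
      have hne : σ - σ' ≠ 0 := by linarith
      convert h ((σ * β' - σ' * β) / (σ - σ')) using 3
      field_simp
      ring
    · right
      have hβ : β = β' := by
        have := hb (sub_self _)
        field_simp at this
        linarith
      subst hβ
      simpa [hσ.ne'] using h 0
  · rintro (⟨hlt, h⟩ | ⟨rfl, rfl, h⟩) t
    · refine h.trans (mul_le_mul_of_nonneg_left (Real.exp_le_exp.mpr ?_) hr.le)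
      have hd : 0 < σ - σ' := by linarith
      rw [← sub_nonneg]
      have : (t - β') ^ 2 / (4 * σ') - (t - β) ^ 2 / (4 * σ) -
          -(β - β') ^ 2 / (4 * (σ - σ')) =
          ((σ - σ') * t - (σ * β' - σ' * β)) ^ 2 / (4 * σ * σ' * (σ - σ')) := by
        field_simp
        ring
      rw [this]
      positivity
    · simpa [hσ.ne'] using h

lemma gaussianPDFReal_two_mul {σ : ℝ} (hσ : 0 < σ) (β t : ℝ) :
    gaussianPDFReal β (2 * σ).toNNReal t =
      (√(4 * Real.pi))⁻¹ * ((√σ)⁻¹ * Real.exp (-((t - β) ^ 2 / (4 * σ)))) := by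
  rw [gaussianPDFReal, Real.coe_toNNReal _ (by positivity),
    show 2 * Real.pi * (2 * σ) = (4 * Real.pi) * σ by ring, Real.sqrt_mul (by positivity),
    mul_inv, mul_assoc]
  congr 3
  ring

lemma mul_gaussianPDFReal_le_iff {σ σ' : ℝ} (hσ : 0 < σ) (hσ' : 0 < σ') (β β' k t : ℝ) :
    k * gaussianPDFReal β' (2 * σ').toNNReal t ≤ gaussianPDFReal β (2 * σ).toNNReal t ↔
      k ≤ √(σ' / σ) * Real.exp ((t - β') ^ 2 / (4 * σ') - (t - β) ^ 2 / (4 * σ)) := by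
  rw [gaussianPDFReal_two_mul hσ, gaussianPDFReal_two_mul hσ', Real.exp_sub,
    Real.sqrt_div hσ'.le, mul_left_comm, mul_le_mul_iff_right₀ (by positivity), Real.exp_neg,
    Real.exp_neg]
  have h1 : 0 < √σ := Real.sqrt_pos.mpr hσ
  have h2 : 0 < √σ' := Real.sqrt_pos.mpr hσ'
  have e1 := Real.exp_pos ((t - β') ^ 2 / (4 * σ'))
  have e2 := Real.exp_pos ((t - β) ^ 2 / (4 * σ))
  generalize Real.exp ((t - β') ^ 2 / (4 * σ')) = x at *
  generalize Real.exp ((t - β) ^ 2 / (4 * σ)) = y at *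
  rw [← mul_inv, ← div_eq_mul_inv, div_le_iff₀ (by positivity)]
  apply Eq.to_iff
  congr 1
  field_simp

lemma continuous_gaussianPDFReal (m : ℝ) (v : NNReal) : Continuous (gaussianPDFReal m v) := by
  unfold gaussianPDFReal
  fun_prop

lemma gaussianReal_real_apply (m : ℝ) {v : NNReal} (hv : v ≠ 0) (S : Set ℝ) :
    (gaussianReal m v).real S = ∫ x in S, gaussianPDFReal m v x := by
  rw [measureReal_def, gaussianReal_apply_eq_integral m hv,
    ENNReal.toReal_ofReal (integral_nonneg fun x ↦ gaussianPDFReal_nonneg m v x)]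

lemma mul_gaussianReal_le_iff (m m' k : ℝ) {v v' : NNReal} (hv : v ≠ 0) (hv' : v' ≠ 0) :
    (∀ S, MeasurableSet S → k * (gaussianReal m' v').real S ≤ (gaussianReal m v).real S) ↔
      ∀ t, k * gaussianPDFReal m' v' t ≤ gaussianPDFReal m v t := by
  simp only [gaussianReal_real_apply _ hv, gaussianReal_real_apply _ hv', ← integral_const_mul]
  have hi := (integrable_gaussianPDFReal m' v').const_mul k
  have hi' := integrable_gaussianPDFReal m v
  constructor
  · intro h
    have hae := ae_le_of_forall_setIntegral_le hi hi' fun S hS _ ↦ h S hS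
    have hcl : IsClosed {t | k * gaussianPDFReal m' v' t ≤ gaussianPDFReal m v t} :=
      isClosed_le ((continuous_gaussianPDFReal m' v').const_mul k) (continuous_gaussianPDFReal m v)
    have hun := (Measure.dense_of_ae hae).closure_eq
    rw [hcl.closure_eq] at hun
    exact fun t ↦ hun.ge (Set.mem_univ t)
  · intro h S _
    exact setIntegral_mono hi.integrableOn hi'.integrableOn h

lemma mul_gaussianReal_le_gaussianReal_iff {σ σ' : ℝ} (hσ : 0 ≤ σ) (hσ' : 0 ≤ σ')
    (β β' : ℝ) {k : ℝ} (hk : 0 < k) :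
    (∀ S, MeasurableSet S → k * (gaussianReal β' (2 * σ').toNNReal).real S ≤
        (gaussianReal β (2 * σ).toNNReal).real S) ↔
      (0 < σ' ∧ σ' < σ ∧ k ≤ √(σ' / σ) * Real.exp (-(β - β') ^ 2 / (4 * (σ - σ')))) ∨
      (σ' = σ ∧ β = β' ∧ k ≤ 1) := by
  have hv {σ : ℝ} (h : 0 < σ) : (2 * σ).toNNReal ≠ 0 := by simpa using h
  rcases hσ'.eq_or_lt with rfl | hσ'
  · rcases hσ.eq_or_lt with rfl | hσ
    · simp only [mul_zero, Real.toNNReal_zero, gaussianReal_zero_var, lt_irrefl, false_and,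
        false_or, true_and]
      constructor
      · intro h
        have := h {β'} (measurableSet_singleton β')
        by_cases hβ : β = β'
        · subst hβ
          simp_all [measureReal_def]
        · simp [measureReal_def, hβ] at this
          linarith
      · rintro ⟨rfl, hk1⟩ S -
        exact mul_le_of_le_one_left measureReal_nonneg hk1
    · have := nullSingletonClass_gaussianReal (μ := β) (hv hσ)
      refine iff_of_false (fun h ↦ ?_) (by simp [hσ.ne])
      have := h {β'} (measurableSet_singleton β')
      simp [measureReal_def] at this
      linarith
  · rcases hσ.eq_or_lt with rfl | hσ
    · have := nullSingletonClass_gaussianReal (μ := β') (hv hσ')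
      refine iff_of_false (fun h ↦ ?_) (by simp [hσ'.ne', hσ'.le])
      have := h {β}ᶜ (measurableSet_singleton β).compl
      rw [probReal_compl_eq_one_sub (measurableSet_singleton β)] at this
      simp [measureReal_def] at this
      linarith
    · rw [mul_gaussianReal_le_iff _ _ _ (hv hσ) (hv hσ')]
      simp only [mul_gaussianPDFReal_le_iff hσ hσ', gaussian_pointwise_le_iff hσ hσ' hk, hσ',
        true_and]

/-- The law on `{0} × ℤ/2ℤ` with masses `(1 + c) / 2` and `(1 - c) / 2`. -/
def twoPointMeasure (c : ℝ) : Measure (ℝ × ZMod 2) :=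
  ((1 + c) / 2).toNNReal • Measure.dirac (0, 0) + ((1 - c) / 2).toNNReal • Measure.dirac (0, 1)

lemma isProbabilityMeasure_twoPointMeasure {c : ℝ} (hc : |c| ≤ 1) :
    IsProbabilityMeasure (twoPointMeasure c) := by
  rw [abs_le] at hc
  have h : ((1 + c) / 2).toNNReal + ((1 - c) / 2).toNNReal = 1 := by
    rw [← Real.toNNReal_add (by linarith) (by linarith)]
    ring_nf
    simp
  constructor
  simp only [twoPointMeasure, Measure.add_apply, Measure.smul_apply, measure_univ,
    ENNReal.smul_def, smul_eq_mul, mul_one]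
  exact_mod_cast h

lemma twoPointMeasure_fst_eq_zero {c : ℝ} (hc : |c| ≤ 1) :
    twoPointMeasure c {p : ℝ × ZMod 2 | p.1 = 0} = 1 := by
  have := isProbabilityMeasure_twoPointMeasure hc
  have hm : MeasurableSet {p : ℝ × ZMod 2 | p.1 = 0} :=
    measurable_fst (measurableSet_singleton (0 : ℝ))
  rw [← prob_compl_eq_zero_iff hm]
  simp [twoPointMeasure, Measure.dirac_apply' _ hm.compl]

lemma conv_twoPointMeasure (G : Measure ℝ) [IsFiniteMeasure G] (c : ℝ) :
    (G.map fun t : ℝ ↦ (t, (0 : ZMod 2))).conv (twoPointMeasure c) =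
      ((1 + c) / 2).toNNReal • G.map (fun t : ℝ ↦ (t, (0 : ZMod 2))) +
        ((1 - c) / 2).toNNReal • G.map (fun t : ℝ ↦ (t, (1 : ZMod 2))) := by
  have hsmul (A : Measure (ℝ × ZMod 2)) [SFinite A] (r : NNReal) (x : ℝ × ZMod 2) :
      A.conv (r • Measure.dirac x) = r • A.map (· + x) := by
    rw [Measure.conv_comm, ENNReal.smul_def, Measure.conv_smul_left, Measure.conv_comm,
      Measure.conv_dirac]
    rfl
  rw [twoPointMeasure, Measure.conv_add, hsmul, hsmul, Measure.map_map (by fun_prop) (by fun_prop),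
    Measure.map_map (by fun_prop) (by fun_prop)]
  simp [Function.comp_def]

lemma toJordanDecomposition_eq_conv {μ : SignedMeasure (ℝ × ZMod 2)} {G : Measure ℝ}
    [IsFiniteMeasure G] {c : ℝ} (hc : |c| ≤ 1)
    (h : ∀ S, MeasurableSet S → μ (S ×ˢ {0}) = (G.real S + c * G.real S) / 2 ∧
      μ (S ×ˢ {1}) = (G.real S - c * G.real S) / 2) :
    μ.toJordanDecomposition.negPart = 0 ∧
      μ.toJordanDecomposition.posPart =
        (G.map fun t : ℝ ↦ (t, (0 : ZMod 2))).conv (twoPointMeasure c) := by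
  have := isProbabilityMeasure_twoPointMeasure hc
  set ν := (G.map fun t : ℝ ↦ (t, (0 : ZMod 2))).conv (twoPointMeasure c) with hν
  have hνS (S : Set (ℝ × ZMod 2)) (hS : MeasurableSet S) :
      ν.real S = (1 + c) / 2 * G.real ((·, 0) ⁻¹' S) + (1 - c) / 2 * G.real ((·, 1) ⁻¹' S) := by
    rw [abs_le] at hc
    rw [hν, conv_twoPointMeasure, measureReal_add_apply, measureReal_nnreal_smul_apply,
      measureReal_nnreal_smul_apply, map_measureReal_apply (by fun_prop) hS,
      map_measureReal_apply (by fun_prop) hS, Real.coe_toNNReal _ (by linarith),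
      Real.coe_toNNReal _ (by linarith)]
  have hj : μ = (JordanDecomposition.mk ν 0 Measure.MutuallySingular.zero_right).toSignedMeasure := by
    refine VectorMeasure.ext fun S hS ↦ ?_
    have m0 : MeasurableSet ((·, (0 : ZMod 2)) ⁻¹' S : Set ℝ) := measurable_prodMk_right hS
    have m1 : MeasurableSet ((·, (1 : ZMod 2)) ⁻¹' S : Set ℝ) := measurable_prodMk_right hS
    rw [JordanDecomposition.toSignedMeasure, _root_.sub_apply,
      Measure.toSignedMeasure_apply_measurable hS, Measure.toSignedMeasure_apply_measurable hS,
      vectorMeasure_apply_eq_add_fibers μ hS, (h _ m0).1, (h _ m1).2, hνS S hS]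
    simp only [measureReal_zero_apply]
    ring
  rw [SignedMeasure.toJordanDecomposition_eq hj]
  exact ⟨rfl, rfl⟩

theorem signed_measure_with_piecewise_gaussian_charFun_nonneg_iff
    (σ σ' : ℝ) (hσ : 0 ≤ σ) (hσ' : 0 ≤ σ') (β β' κ : ℝ) (hκ : κ ≠ 0)
    (μ : SignedMeasure (ℝ × ZMod 2))
    (hμ : ∀ (s : ℝ) (l : ZMod 2),
      sCharZ2 μ s l =
        if l = 0 then Complex.exp (-(σ : ℂ) * (s : ℂ) ^ 2 + Complex.I * (β : ℂ) * (s : ℂ))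
        else (κ : ℂ) *
          Complex.exp (-(σ' : ℂ) * (s : ℂ) ^ 2 + Complex.I * (β' : ℂ) * (s : ℂ))) :
    ((0 : SignedMeasure (ℝ × ZMod 2)) ≤ μ ↔
      (0 < σ' ∧ σ' < σ ∧
        |κ| ≤ Real.sqrt (σ' / σ) * Real.exp (-(β - β') ^ 2 / (4 * (σ - σ')))) ∨
      (σ' = σ ∧ β = β' ∧ |κ| ≤ 1)) ∧
    (σ' = σ ∧ β = β' ∧ |κ| ≤ 1 →
      ∃ (m : ℝ) (v : NNReal) (lam : Measure (ℝ × ZMod 2)), IsProbabilityMeasure lam ∧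
        lam {p : ℝ × ZMod 2 | p.1 = 0} = 1 ∧
        μ.toJordanDecomposition.negPart = 0 ∧
        μ.toJordanDecomposition.posPart =
          (Measure.map (fun t : ℝ => (t, (0 : ZMod 2)))
            (ProbabilityTheory.gaussianReal m v)).conv lam) := by
  have h0 (s : ℝ) : sCharZ2 μ s 0 = charFun (gaussianReal β (2 * σ).toNNReal) s := by
    rw [hμ, if_pos rfl, gaussian_charFun_eq hσ]
  have h1 (s : ℝ) : sCharZ2 μ s 1 = κ * charFun (gaussianReal β' (2 * σ').toNNReal) s := by
    rw [hμ, if_neg one_ne_zero, gaussian_charFun_eq hσ']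
  have h (S : Set ℝ) (hS : MeasurableSet S) := signedMeasure_apply_fiber h0 h1 hS
  refine ⟨?_, ?_⟩
  · rw [signedMeasure_nonneg_iff h,
      mul_gaussianReal_le_gaussianReal_iff hσ hσ' β β' (abs_pos.mpr hκ)]
  · rintro ⟨rfl, rfl, hk⟩
    exact ⟨β, _, twoPointMeasure κ, isProbabilityMeasure_twoPointMeasure hk,
      twoPointMeasure_fst_eq_zero hk, toJordanDecomposition_eq_conv hk h⟩

end
end

section
/- Let μ₁, μ₂ be probability measures on ℝ and let α be a real number with α ≠ 0 and α ≠ −1. If the pushforward of μ₁ ⊗ μ₂ under (x₁,x₂) ↦ (x₁+x₂, x₁+αx₂) equals its pushforward under (x₁,x₂) ↦ (x₁+x₂, −(x₁+αx₂)), then μ₁ and μ₂ are (possibly degenerate) Gaussian distributions on ℝ: for j = 1, 2 there exist m_j ∈ ℝ and v_j ≥ 0 such that μ_j is the Gaussian measure on ℝ with mean m_j and variance v_j (the Dirac measure δ_{m_j} when v_j = 0). -/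
open MeasureTheory ProbabilityTheory

noncomputable section

open Complex in
lemma integral_prod_exp_eq_charFun_mul (μ ν : Measure ℝ) [IsProbabilityMeasure μ]
    [IsProbabilityMeasure ν] (a b : ℝ) :
    ∫ p : ℝ × ℝ, cexp ((a * p.1 + b * p.2) * I) ∂(μ.prod ν) = charFun μ a * charFun ν b := by
  simp_rw [charFun_apply_real, add_mul, Complex.exp_add]
  exact integral_prod_mul (fun x : ℝ => cexp (a * x * I)) (fun y : ℝ => cexp (b * y * I))

open Complex in
lemma charFun_mul_eq_of_map_eq_map_neg {μ₁ μ₂ : Measure ℝ} [IsProbabilityMeasure μ₁]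
    [IsProbabilityMeasure μ₂] {α : ℝ}
    (hsym : Measure.map (fun p : ℝ × ℝ => (p.1 + p.2, p.1 + α * p.2)) (μ₁.prod μ₂) =
      Measure.map (fun p : ℝ × ℝ => (p.1 + p.2, -(p.1 + α * p.2))) (μ₁.prod μ₂)) (u v : ℝ) :
    charFun μ₁ (u + v) * charFun μ₂ (u + α * v) =
      charFun μ₁ (u - v) * charFun μ₂ (u - α * v) := by
  have h := congrArg (fun m => ∫ p : ℝ × ℝ, cexp ((u * p.1 + v * p.2) * I) ∂m) hsym
  rw [integral_map (by fun_prop) (by fun_prop), integral_map (by fun_prop) (by fun_prop)] at h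
  rw [← integral_prod_exp_eq_charFun_mul, ← integral_prod_exp_eq_charFun_mul]
  convert h using 5 <;> · push_cast; ring

lemma eq_dirac_of_norm_charFun_eq_one {μ : Measure ℝ} [IsProbabilityMeasure μ]
    (h : ∀ t, ‖charFun μ t‖ = 1) : ∃ m : ℝ, μ = Measure.dirac m := by
  have hsub : (μ.prod μ).map (fun p : ℝ × ℝ => p.1 - p.2) = Measure.dirac 0 := by
    refine Measure.ext_of_charFun (funext fun t => ?_)
    rw [charFun_apply_real, integral_map (by fun_prop) (by fun_prop)]
    have : charFun μ t * charFun μ (-t) = 1 := by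
      rw [charFun_neg, Complex.mul_conj, Complex.normSq_eq_norm_sq, h]
      simp
    rw [← integral_prod_exp_eq_charFun_mul] at this
    rw [charFun_dirac]
    simp only [inner_zero_left, Complex.ofReal_zero, zero_mul, Complex.exp_zero]
    rw [← this]
    congr 1 with p
    push_cast
    ring_nf
  have hae : ∀ᵐ p ∂(μ.prod μ), p.1 - p.2 = 0 := by
    refine ae_of_ae_map (f := fun p : ℝ × ℝ => p.1 - p.2) (p := fun x => x = 0) (by fun_prop) ?_
    rw [hsub, ae_dirac_eq]
    rfl
  obtain ⟨x, hx⟩ := (Measure.ae_ae_of_ae_prod hae).exists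
  refine ⟨x, ?_⟩
  have hid : id =ᵐ[μ] fun _ => x := by
    filter_upwards [hx] with y hy
    simp only [id]
    linarith
  rw [← Measure.map_id (μ := μ), Measure.map_congr hid, Measure.map_const]
  simp

open Filter Topology in
lemma norm_le_norm_of_norm_comp_mul_le {E : Type*} [SeminormedAddCommGroup E] {f : ℝ → E}
    (hf : Continuous f) {k : ℝ} (hk : |k| < 1) (h : ∀ s, ‖f (k * s)‖ ≤ ‖f s‖) (s : ℝ) :
    ‖f 0‖ ≤ ‖f s‖ := by
  have hle : ∀ n : ℕ, ‖f (k ^ n * s)‖ ≤ ‖f s‖ := by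
    intro n
    induction n with
    | zero => simp
    | succ n ih =>
      rw [pow_succ', mul_assoc]
      exact (h _).trans ih
  have hlim : Tendsto (fun n : ℕ => ‖f (k ^ n * s)‖) atTop (𝓝 ‖f 0‖) := by
    have h0 : Tendsto (fun n : ℕ => k ^ n * s) atTop (𝓝 0) := by
      simpa using (tendsto_pow_atTop_nhds_zero_of_abs_lt_one hk).mul_const s
    exact (hf.norm.tendsto 0).comp h0
  exact le_of_tendsto' hlim hle

lemma hasDerivAt_integral_comp_affine {g : ℝ → ℂ} (hg : Continuous g) (a : ℝ) {b : ℝ} (hb : b ≠ 0)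
    (s : ℝ) :
    HasDerivAt (fun s => ∫ t in (0 : ℝ)..1, g (a * s + b * t))
      (b⁻¹ • (a • g (a * s + b) - a • g (a * s))) s := by
  have hF : ∀ x, HasDerivAt (fun x => ∫ t in (0 : ℝ)..x, g t) (g x) x := fun x =>
    intervalIntegral.integral_hasDerivAt_right (hg.intervalIntegrable _ _)
      (hg.stronglyMeasurableAtFilter _ _) hg.continuousAt
  have heq : (fun s => ∫ t in (0 : ℝ)..1, g (a * s + b * t)) =
      fun s => b⁻¹ • ((∫ t in (0 : ℝ)..(a * s + b), g t) - ∫ t in (0 : ℝ)..(a * s), g t) := by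
    funext s
    rw [intervalIntegral.integral_comp_add_mul (f := g) hb,
      intervalIntegral.integral_interval_sub_left (hg.intervalIntegrable _ _)
        (hg.intervalIntegrable _ _)]
    simp
  rw [heq]
  have h1 : HasDerivAt (fun s : ℝ => a * s) a s := by
    simpa using (hasDerivAt_id s).const_mul a
  exact (((hF _).scomp s (h1.add_const b)).sub ((hF _).scomp s h1)).const_smul b⁻¹

lemma exists_continuous_hasDerivAt_of_add_eq {φ χ : ℝ → ℂ} (hφ : Continuous φ)
    (hχ : Continuous χ) {a b c d : ℝ} (hb : b ≠ 0) (hd : d ≠ 0)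
    (h : ∀ s t, φ s + χ t = φ (a * s + b * t) + χ (c * s + d * t)) :
    ∃ φ' : ℝ → ℂ, Continuous φ' ∧ ∀ s, HasDerivAt φ (φ' s) s := by
  refine ⟨fun s => b⁻¹ • (a • φ (a * s + b) - a • φ (a * s)) +
    d⁻¹ • (c • χ (c * s + d) - c • χ (c * s)), by fun_prop, fun s => ?_⟩
  have heq : φ = fun s => ((∫ t in (0 : ℝ)..1, φ (a * s + b * t)) +
      ∫ t in (0 : ℝ)..1, χ (c * s + d * t)) - ∫ t in (0 : ℝ)..1, χ t := by
    funext s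
    rw [← intervalIntegral.integral_add
      (Continuous.intervalIntegrable (by fun_prop) _ _)
      (Continuous.intervalIntegrable (by fun_prop) _ _)]
    simp_rw [← h]
    rw [intervalIntegral.integral_add (by simp) (hχ.intervalIntegrable _ _)]
    simp
  exact (((hasDerivAt_integral_comp_affine hφ a hb s).add
    (hasDerivAt_integral_comp_affine hχ c hd s)).sub_const _).congr_of_eventuallyEq heq.eventuallyEq

/-- Continuous solutions of a functional equation given by a linear involution of the plane are
quadratic polynomials. -/
lemma exists_quadratic_of_add_eq {φ χ : ℝ → ℂ} (hφ : Continuous φ) (hχ : Continuous χ)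
    (hφ0 : φ 0 = 0) {a b c : ℝ} (ha : a ≠ 0) (hb : b ≠ 0) (hc : c ≠ 0) (hinv : a ^ 2 + b * c = 1)
    (h : ∀ s t, φ s + χ t = φ (a * s + b * t) + χ (c * s + -a * t)) :
    ∃ m n : ℂ, ∀ s : ℝ, φ s = m * s + n * s ^ 2 := by
  obtain ⟨φ', hφ'c, hφ'⟩ := exists_continuous_hasDerivAt_of_add_eq hφ hχ hb (neg_ne_zero.2 ha) h
  obtain ⟨χ', -, hχ'⟩ := exists_continuous_hasDerivAt_of_add_eq (a := -a) (b := c) (c := b) (d := a)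
    hχ hφ hc ha (fun t s => by
      rw [add_comm, h s t, add_comm]; congr 2 <;> ring)
  have hder : ∀ s t, φ' s = a • φ' (a * s + b * t) + c • χ' (c * s + -a * t) := by
    intro s t
    have h1 : ∀ k l : ℝ, HasDerivAt (fun s : ℝ => k * s + l) k s := fun k l => by
      simpa using ((hasDerivAt_id s).const_mul k).add_const l
    have h2 := ((hφ' _).scomp s (h1 a (b * t))).add ((hχ' _).scomp s (h1 c (-a * t)))
    refine ((hφ' s).add_const (χ t)).unique (h2.congr_of_eventuallyEq ?_)
    exact Filter.Eventually.of_forall fun s => h s t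
  have hder' : ∀ x y, φ' (a * x + b * y) = a • φ' x + c • χ' y := by
    intro x y
    convert hder (a * x + b * y) (c * x + -a * y) using 4
    · linear_combination -x * hinv
    · linear_combination -y * hinv
  have hadd : ∀ x y, (φ' (x + y) - φ' 0) = (φ' x - φ' 0) + (φ' y - φ' 0) := by
    intro x y
    have e1 := hder' (x / a) (y / b)
    have e2 := hder' (x / a) 0
    have e3 := hder' 0 (y / b)
    have e4 := hder' 0 0
    simp only [mul_div_cancel₀ _ ha, mul_div_cancel₀ _ hb, mul_zero, add_zero, zero_add]
      at e1 e2 e3 e4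
    linear_combination e1 - e2 - e3 + e4
  let L : ℝ →+ ℂ := AddMonoidHom.mk' (fun x => φ' x - φ' 0) hadd
  have hL : ∀ x : ℝ, φ' x - φ' 0 = x * (φ' 1 - φ' 0) := by
    intro x
    have := map_real_smul L (show Continuous (fun x => φ' x - φ' 0) by fun_prop) x 1
    simpa [L] using this
  refine ⟨φ' 0, (φ' 1 - φ' 0) / 2, fun s => ?_⟩
  have hd0 : ∀ x, HasDerivAt
      (fun x : ℝ => φ x - (φ' 0 * x + (φ' 1 - φ' 0) / 2 * (x : ℂ) ^ 2)) 0 x := by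
    intro x
    have h1 : HasDerivAt (fun x : ℝ => (x : ℂ)) 1 x := Complex.ofRealCLM.hasDerivAt
    refine ((hφ' x).sub ((h1.const_mul (φ' 0)).add
      ((h1.pow 2).const_mul ((φ' 1 - φ' 0) / 2)))).congr_deriv ?_
    push_cast
    linear_combination hL x
  have := is_const_of_deriv_eq_zero (fun x => (hd0 x).differentiableAt)
    (fun x => (hd0 x).deriv) s 0
  simp only [hφ0, Complex.ofReal_zero] at this
  linear_combination this

open Filter Topology in
lemma ne_zero_of_mul_eq {f g : ℝ → ℂ} (hf : Continuous f) (hg : Continuous g) (hf0 : f 0 = 1)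
    (hg0 : g 0 = 1) {a b c : ℝ} (ha : a ≠ 0) (hb : 0 < b) (hc : 0 < c)
    (hinv : a ^ 2 + b * c = 1) (h : ∀ s t, f s * g t = f (a * s + b * t) * g (c * s + -a * t)) :
    (∀ s, f s ≠ 0) ∧ ∀ t, g t ≠ 0 := by
  obtain ⟨δ, hδ, hnear⟩ : ∃ δ > 0, ∀ x, |x| < δ → f x ≠ 0 ∧ g x ≠ 0 := by
    have h1 : ∀ᶠ x in 𝓝 (0 : ℝ), f x ≠ 0 ∧ g x ≠ 0 :=
      (hf.continuousAt.eventually_ne (by simp [hf0])).and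
        (hg.continuousAt.eventually_ne (by simp [hg0]))
    obtain ⟨δ, hδ, hball⟩ := Metric.eventually_nhds_iff.1 h1
    exact ⟨δ, hδ, fun x hx => hball (by simpa using hx)⟩
  obtain ⟨q, hq0, hq1, haq, hbcq⟩ : ∃ q : ℝ, 0 < q ∧ q < 1 ∧ a ^ 2 ≤ q ∧ b * c ≤ q := by
    have h1 : 0 < a ^ 2 := by positivity
    have h2 : 0 < b * c := by positivity
    exact ⟨max (a ^ 2) (b * c), lt_max_of_lt_left h1, max_lt (by linarith) (by linarith),
      le_max_left _ _, le_max_right _ _⟩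
  set ε := δ ^ 2 * min b c with hε
  have hεpos : 0 < ε := by positivity
  have hscale : ∀ n : ℕ, (∀ s, c * s ^ 2 * q ^ n < ε → f s ≠ 0) ∧
      ∀ t, b * t ^ 2 * q ^ n < ε → g t ≠ 0 := by
    intro n
    induction n with
    | zero =>
      have hsmall : ∀ w, min b c ≤ w → 0 < w → ∀ x, w * x ^ 2 * q ^ 0 < ε → |x| < δ := by
        intro w hw hw0 x hx
        have hle : ε ≤ w * δ ^ 2 := by rw [hε, mul_comm]; gcongr
        have : x ^ 2 < δ ^ 2 := by
          refine lt_of_mul_lt_mul_left ?_ hw0.le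
          linarith [hx, hle]
        exact abs_lt_of_sq_lt_sq this hδ.le
      exact ⟨fun s hs => (hnear s (hsmall c (min_le_right _ _) hc s hs)).1,
        fun t ht => (hnear t (hsmall b (min_le_left _ _) hb t ht)).2⟩
    | succ n ih =>
      have hqn : 0 < q ^ n := by positivity
      have hcontr : ∀ w x k, 0 ≤ w → k ≤ q → w * x ^ 2 * q ^ (n + 1) < ε →
          k * (w * x ^ 2) * q ^ n < ε := by
        intro w x k hw hk hlt
        refine lt_of_le_of_lt ?_ hlt
        calc k * (w * x ^ 2) * q ^ n ≤ q * (w * x ^ 2) * q ^ n := by gcongr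
          _ = w * x ^ 2 * q ^ (n + 1) := by ring
      constructor
      · intro s hs
        have h1 := h s 0
        simp only [mul_zero, add_zero, hg0, mul_one] at h1
        rw [h1]
        refine mul_ne_zero (ih.1 _ ?_) (ih.2 _ ?_)
        · convert hcontr c s _ hc.le haq hs using 2; ring
        · convert hcontr c s _ hc.le hbcq hs using 2; ring
      · intro t ht
        have h1 := h 0 t
        simp only [mul_zero, zero_add, hf0, one_mul] at h1
        rw [h1]
        refine mul_ne_zero (ih.1 _ ?_) (ih.2 _ ?_)
        · convert hcontr b t _ hb.le hbcq ht using 2; ring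
        · convert hcontr b t _ hb.le haq ht using 2; ring
  have hex : ∀ y : ℝ, ∃ n : ℕ, y * q ^ n < ε := by
    intro y
    have h0 : Tendsto (fun n : ℕ => y * q ^ n) atTop (𝓝 0) := by
      simpa using (tendsto_pow_atTop_nhds_zero_of_lt_one hq0.le hq1).const_mul y
    exact (h0.eventually_lt_const hεpos).exists
  constructor
  · intro s
    obtain ⟨n, hn⟩ := hex (c * s ^ 2)
    exact (hscale n).1 s hn
  · intro t
    obtain ⟨n, hn⟩ := hex (b * t ^ 2)
    exact (hscale n).2 t hn

lemma exists_continuous_log {f : ℝ → ℂ} (hf : Continuous f) (hf0 : f 0 = 1) (hne : ∀ s, f s ≠ 0) :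
    ∃ φ : ℝ → ℂ, Continuous φ ∧ φ 0 = 0 ∧ ∀ s, Complex.exp (φ s) = f s := by
  obtain ⟨F, ⟨hF0, hF⟩, -⟩ := Complex.isCoveringMapOn_exp.existsUnique_continuousMap_lifts
    ⟨f, hf⟩ (a₀ := 0) (e₀ := 0) (by simp [hf0]) hne
  exact ⟨F, F.continuous, hF0, fun s => congrFun hF s⟩

lemma eq_of_exp_eq {A : Type*} [TopologicalSpace A] [SimplyConnectedSpace A]
    [LocallyPathConnectedSpace A] {F G : A → ℂ} (hF : Continuous F) (hG : Continuous G) (a : A)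
    (ha : F a = G a) (h : ∀ x, Complex.exp (F x) = Complex.exp (G x)) : F = G := by
  have := (Complex.isCoveringMapOn_exp.existsUnique_continuousMap_lifts
    (⟨fun x => Complex.exp (G x), by fun_prop⟩ : C(A, ℂ)) (a₀ := a) (e₀ := G a) rfl
    (fun x => by simp)).unique (y₁ := ⟨F, hF⟩) (y₂ := ⟨G, hG⟩)
    ⟨ha, funext h⟩ ⟨rfl, rfl⟩
  exact congrArg DFunLike.coe this

open Complex in
lemma eq_gaussianReal_of_charFun_eq_exp {μ : Measure ℝ} [IsProbabilityMeasure μ] {m n : ℂ}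
    (h : ∀ s : ℝ, charFun μ s = cexp (m * s + n * s ^ 2)) :
    ∃ (x : ℝ) (v : NNReal), μ = gaussianReal x v := by
  have hre : ∀ s : ℝ, (m * s + n * (s : ℂ) ^ 2).re = m.re * s + n.re * s ^ 2 := by
    intro s; simp [← ofReal_pow]
  have him : ∀ s : ℝ, (m * s + n * (s : ℂ) ^ 2).im = m.im * s + n.im * s ^ 2 := by
    intro s; simp [← ofReal_pow]
  have hle : ∀ s : ℝ, m.re * s + n.re * s ^ 2 ≤ 0 := by
    intro s
    have := norm_charFun_le_one (μ := μ) s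
    rwa [h, norm_exp, hre, Real.exp_le_one_iff] at this
  have hnre : n.re ≤ 0 := by linarith [hle 1, hle (-1)]
  have hconj : ∀ s : ℝ, cexp (m * (-s : ℝ) + n * (-s : ℝ) ^ 2) =
      cexp ((starRingEnd ℂ) (m * s + n * s ^ 2)) := by
    intro s
    rw [← h, charFun_neg, h, exp_conj]
  have hmre : m.re = 0 := by
    have := congrArg norm (hconj 1)
    rw [norm_exp, norm_exp, conj_re, hre, hre, Real.exp_eq_exp] at this
    linarith
  have hnim : n.im = 0 := by
    by_contra hne
    set r := Real.sqrt (Real.pi / (2 * |n.im|)) with hr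
    have hr2 : r ^ 2 = Real.pi / (2 * |n.im|) := Real.sq_sqrt (by positivity)
    obtain ⟨k, hk⟩ := exp_eq_exp_iff_exists_int.1 (hconj r)
    have hk' := congrArg Complex.im hk
    rw [him, add_im, conj_im, him] at hk'
    simp only [mul_im, mul_re, intCast_re, intCast_im, ofReal_re, ofReal_im, I_re, I_im] at hk'
    norm_num at hk'
    have habs : |n.im| * r ^ 2 = Real.pi / 2 := by
      rw [hr2]; field_simp
    have h2 : n.im * r ^ 2 = k * Real.pi := by linarith
    have h3 : |(k : ℝ)| * Real.pi = Real.pi / 2 := by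
      rw [← habs, ← abs_of_pos Real.pi_pos, ← abs_mul, ← h2, abs_mul, abs_of_nonneg (sq_nonneg r)]
    have h4 : |(k : ℝ)| = 1 / 2 := by
      have := Real.pi_pos
      field_simp
      field_simp at h3
      linarith
    have h5 : (2 : ℝ) * |(k : ℝ)| = 1 := by linarith
    have h6 : 2 * |k| = 1 := by exact_mod_cast h5
    omega
  refine ⟨m.im, (-2 * n.re).toNNReal, Measure.ext_of_charFun (funext fun s => ?_)⟩
  rw [h, charFun_gaussianReal]
  have hm : m = m.im * I := by apply Complex.ext <;> simp [hmre]
  have hn : n = n.re := by apply Complex.ext <;> simp [hnim]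
  congr 1
  conv_lhs => rw [hm, hn]
  rw [Real.coe_toNNReal _ (by linarith)]
  push_cast
  ring

theorem heyde_theorem_on_real_line_two_variables
    (μ₁ μ₂ : Measure ℝ) [IsProbabilityMeasure μ₁] [IsProbabilityMeasure μ₂]
    (α : ℝ) (hα0 : α ≠ 0) (hα1 : α ≠ -1)
    (hsym : Measure.map (fun p : ℝ × ℝ => (p.1 + p.2, p.1 + α * p.2)) (μ₁.prod μ₂) =
      Measure.map (fun p : ℝ × ℝ => (p.1 + p.2, -(p.1 + α * p.2))) (μ₁.prod μ₂)) :
    ∃ (m₁ m₂ : ℝ) (v₁ v₂ : NNReal),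
      μ₁ = gaussianReal m₁ v₁ ∧ μ₂ = gaussianReal m₂ v₂ := by
  have heq := charFun_mul_eq_of_map_eq_map_neg hsym
  have hf : Continuous (charFun μ₁) := continuous_charFun
  have hg : Continuous (charFun μ₂) := continuous_charFun
  have hf0 : charFun μ₁ 0 = 1 := by simp
  have hg0 : charFun μ₂ 0 = 1 := by simp
  rcases lt_or_gt_of_ne hα0 with hneg | hpos
  · have hα : α - 1 ≠ 0 := by linarith
    have hα' : α + 1 ≠ 0 := fun h0 => hα1 (by linarith)
    obtain ⟨a, ha_def⟩ : ∃ a, a = (α + 1) / (α - 1) := ⟨_, rfl⟩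
    obtain ⟨b, hb_def⟩ : ∃ b, b = -2 / (α - 1) := ⟨_, rfl⟩
    obtain ⟨c, hc_def⟩ : ∃ c, c = 2 * α / (α - 1) := ⟨_, rfl⟩
    have ha : a ≠ 0 := by rw [ha_def]; exact div_ne_zero hα' hα
    have hb : 0 < b := by rw [hb_def]; exact div_pos_of_neg_of_neg (by norm_num) (by linarith)
    have hc : 0 < c := by rw [hc_def]; exact div_pos_of_neg_of_neg (by linarith) (by linarith)
    have hinv : a ^ 2 + b * c = 1 := by
      rw [ha_def, hb_def, hc_def]; field_simp; ring
    have hmul : ∀ s t, charFun μ₁ s * charFun μ₂ t =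
        charFun μ₁ (a * s + b * t) * charFun μ₂ (c * s + -a * t) := by
      intro s t
      have e := heq ((α * s - t) / (α - 1)) ((t - s) / (α - 1))
      convert e using 3 <;> (try rw [ha_def]) <;> (try rw [hb_def]) <;> (try rw [hc_def]) <;>
        field_simp <;> ring
    obtain ⟨hfne, hgne⟩ := ne_zero_of_mul_eq hf hg hf0 hg0 ha hb hc hinv hmul
    obtain ⟨φ, hφ, hφ0, hφexp⟩ := exists_continuous_log hf hf0 hfne
    obtain ⟨χ, hχ, hχ0, hχexp⟩ := exists_continuous_log hg hg0 hgne
    have hadd : (fun p : ℝ × ℝ => φ p.1 + χ p.2) =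
        fun p => φ (a * p.1 + b * p.2) + χ (c * p.1 + -a * p.2) := by
      refine eq_of_exp_eq (by fun_prop) (by fun_prop) (0, 0) (by simp) fun p => ?_
      simp only [Complex.exp_add, hφexp, hχexp]
      exact hmul _ _
    have hadd' : ∀ s t, φ s + χ t = φ (a * s + b * t) + χ (c * s + -a * t) :=
      fun s t => congrFun hadd (s, t)
    obtain ⟨m, n, hmn⟩ := exists_quadratic_of_add_eq hφ hχ hφ0 ha hb.ne' hc.ne' hinv hadd'
    obtain ⟨m', n', hmn'⟩ := exists_quadratic_of_add_eq (a := -a) (b := c) (c := b) hχ hφ hχ0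
      (neg_ne_zero.2 ha) hc.ne' hb.ne' (by linarith) (fun t s => by
        rw [add_comm, hadd' s t, add_comm]; congr 2 <;> ring)
    obtain ⟨m₁, v₁, h₁⟩ := eq_gaussianReal_of_charFun_eq_exp (μ := μ₁)
      fun s => by rw [← hφexp, hmn]
    obtain ⟨m₂, v₂, h₂⟩ := eq_gaussianReal_of_charFun_eq_exp (μ := μ₂)
      fun s => by rw [← hχexp, hmn']
    exact ⟨m₁, m₂, v₁, v₂, h₁, h₂⟩
  · have hα : 0 < 1 + α := by linarith
    have hk : |(1 - α) / (1 + α)| < 1 := by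
      rw [abs_div, abs_of_pos hα, div_lt_one hα, abs_lt]
      constructor <;> linarith
    have hk' : |-((1 - α) / (1 + α))| < 1 := by rwa [abs_neg]
    have hf1 : ∀ s, ‖charFun μ₁ s‖ = 1 := by
      refine fun s => le_antisymm (norm_charFun_le_one s) ?_
      have := norm_le_norm_of_norm_comp_mul_le hf hk' (fun s => ?_) s
      · simpa [hf0] using this
      · have e := heq (α * (s / (1 + α))) (s / (1 + α))
        rw [sub_self, hg0, mul_one, show α * (s / (1 + α)) + s / (1 + α) = s by field_simp; ring,
          show α * (s / (1 + α)) - s / (1 + α) = -((1 - α) / (1 + α)) * s by ring] at e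
        rw [← e, norm_mul]
        exact mul_le_of_le_one_right (norm_nonneg _) (norm_charFun_le_one _)
    have hg1 : ∀ s, ‖charFun μ₂ s‖ = 1 := by
      refine fun s => le_antisymm (norm_charFun_le_one s) ?_
      have := norm_le_norm_of_norm_comp_mul_le hg hk (fun s => ?_) s
      · simpa [hg0] using this
      · have e := heq (s / (1 + α)) (s / (1 + α))
        rw [sub_self, hf0, one_mul, show s / (1 + α) + α * (s / (1 + α)) = s by field_simp,
          show s / (1 + α) - α * (s / (1 + α)) = (1 - α) / (1 + α) * s by ring] at e
        rw [← e, norm_mul]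
        exact mul_le_of_le_one_left (norm_nonneg _) (norm_charFun_le_one _)
    obtain ⟨m₁, h₁⟩ := eq_dirac_of_norm_charFun_eq_one hf1
    obtain ⟨m₂, h₂⟩ := eq_dirac_of_norm_charFun_eq_one hg1
    exact ⟨m₁, m₂, 0, 0, by simpa using h₁, by simpa using h₂⟩

end
end
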